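/- No two distinct economical cyclic words in letters a, b are equivalent: if two economical cyclic words are equivalent, then they are equal as cyclic words (i.e., one is a cyclic rotation of the other). -/

import Mathlib

/-- The two-letter alphabet `{a, b}`. -/
inductive AB : Type
  | a : AB
  | b : AB
deriving DecidableEq

/-- Equality of words up to cyclic rotation (equality as cyclic words). -/
def CycEq {α : Type*} (w₁ w₂ : List α) : Prop := ∃ n : ℕ, w₂ = w₁.rotate n

/-- The letter at the position cyclically following `i`. -/
def cnext {α : Type*} (w : List α) (i : Fin w.length) : α :=
  w.get ⟨(i.1 + 1) % w.length, Nat.mod_lt _ (Nat.lt_of_le_of_lt (Nat.zero_le _) i.isLt)⟩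

/-- Elementary cancellation of a cyclic word in letters `a`, `b`: deletion of two
cyclically adjacent equal letters. -/
def CancelW (w w' : List AB) : Prop :=
  ∃ (x : AB) (rest : List AB), CycEq w (x :: x :: rest) ∧ CycEq w' rest

/-- A cyclic word is economical if no two cyclically adjacent positions carry
equal letters (words of length at most 1 are economical). -/
def EconomicalW (w : List AB) : Prop :=
  2 ≤ w.length → ∀ i : Fin w.length, w.get i ≠ cnext w i


/-- Equivalence of cyclic words: generated by elementary cancellations
(in either direction). -/
def EquivW : List AB → List AB → Prop :=
  Relation.EqvGen (fun w w' => CycEq w w' ∨ CancelW w w')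

def AB.fl : AB → AB
  | .a => .b
  | .b => .a

def AB.be : AB → ℤ
  | .a => 0
  | .b => 1

def altT : List AB → ℤ
  | [] => 0
  | x :: l => x.be - altT l

def altInv (w : List AB) : ℕ × ℤ :=
  (w.length % 2, if w.length % 2 = 0 then |altT w| else altT w % 2)

def altW (x : AB) : ℕ → List AB
  | 0 => []
  | n + 1 => x :: altW x.fl n

theorem altT_snoc (l : List AB) (x : AB) :
    altT (l ++ [x]) = altT l + (if l.length % 2 = 0 then x.be else - x.be) := by
  induction l with
  | nil => simp [altT]
  | cons y l ih =>
    simp only [List.cons_append, altT, ih, List.length_cons]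
    split_ifs <;> first | omega | ring

theorem altInv_rotate (w : List AB) (n : ℕ) : altInv (w.rotate n) = altInv w := by
  induction n generalizing w with
  | zero => simp
  | succ n ih =>
    cases w with
    | nil => simp
    | cons x l =>
      rw [List.rotate_cons_succ, ih]
      unfold altInv
      simp only [List.length_append, List.length_cons, List.length_nil, altT_snoc, altT, zero_add]
      congr 1
      by_cases h : l.length % 2 = 0
      · have h1 : (l.length + 1) % 2 ≠ 0 := by omega
        simp only [h, h1, if_true, if_false]
        omega
      · have h1 : (l.length + 1) % 2 = 0 := by omega
        simp only [h, h1, if_true, if_false]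
        rw [← abs_neg]
        congr 1
        ring

theorem altInv_cyc {w w' : List AB} (h : CycEq w w') : altInv w = altInv w' := by
  obtain ⟨n, rfl⟩ := h
  exact (altInv_rotate w n).symm

theorem altInv_cancel (x : AB) (l : List AB) : altInv (x :: x :: l) = altInv l := by
  simp [altInv, altT, add_assoc]

theorem altInv_equiv {u v : List AB} (h : EquivW u v) : altInv u = altInv v := by
  unfold EquivW at h
  induction h with
  | rel x y h =>
    rcases h with h | ⟨c, r, h1, h2⟩
    · exact altInv_cyc h
    · rw [altInv_cyc h1, altInv_cyc h2, altInv_cancel]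
  | refl => rfl
  | symm _ _ _ ih => exact ih.symm
  | trans _ _ _ _ _ ih1 ih2 => exact ih1.trans ih2

theorem AB.fl_fl (x : AB) : x.fl.fl = x := by cases x <;> rfl

theorem AB.eq_fl {x y : AB} (h : x ≠ y) : y = x.fl := by
  cases x <;> cases y <;> simp_all [AB.fl]

theorem altW_length (x : AB) (n : ℕ) : (altW x n).length = n := by
  induction n generalizing x with
  | zero => rfl
  | succ n ih => simp [altW, ih]

theorem altW_snoc (x : AB) (n : ℕ) :
    altW x (n + 1) = altW x n ++ [if n % 2 = 0 then x else x.fl] := by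
  induction n generalizing x with
  | zero => rfl
  | succ n ih =>
    rw [altW, ih, altW, AB.fl_fl, List.cons_append]
    congr 3
    split_ifs <;> first | omega | rfl

theorem altW_T (x : AB) (m : ℕ) : altT (altW x (2 * m)) = m * (x.be - x.fl.be) := by
  induction m with
  | zero => simp [altW, altT]
  | succ m ih =>
    rw [show 2 * (m + 1) = 2 * m + 1 + 1 by ring, altW, altW, AB.fl_fl, altT, altT, ih]
    push_cast
    ring

theorem altW_inv (x : AB) (m : ℕ) : altInv (altW x (2 * m)) = (0, (m : ℤ)) := by
  simp only [altInv, altW_length, altW_T]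
  cases x <;> simp [AB.be, AB.fl]

theorem chain_altW (x : AB) (l : List AB)
    (h : ∀ i (hi : i + 1 < (x :: l).length), (x :: l)[i] ≠ (x :: l)[i + 1]) :
    x :: l = altW x (l.length + 1) := by
  induction l generalizing x with
  | nil => rfl
  | cons y l ih =>
    have h0 := AB.eq_fl (h 0 (by simp))
    simp only [List.getElem_cons_zero, List.getElem_cons_succ] at h0
    rw [altW]
    congr 1
    rw [← h0]
    apply ih
    intro i hi
    exact h (i + 1) (by simp at hi ⊢; omega)

theorem econ_form (w : List AB) (h : EconomicalW w) :
    (∃ x, w = [x]) ∨ ∃ x m, w = altW x (2 * m) := by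
  rcases w with _ | ⟨x, _ | ⟨y, l⟩⟩
  · exact Or.inr ⟨.a, 0, rfl⟩
  · exact Or.inl ⟨x, rfl⟩
  · right
    have h := h (by simp)
    have e := chain_altW x (y :: l) (by
      intro i hi
      have := h ⟨i, by omega⟩
      simp only [cnext, List.get_eq_getElem, Nat.mod_eq_of_lt hi] at this
      exact this)
    have hl := h ⟨l.length + 1, by simp⟩
    simp only [cnext, List.get_eq_getElem, List.length_cons, Nat.mod_self,
      List.getElem_cons_zero] at hl
    simp only [List.length_cons] at e
    by_cases hp : l.length % 2 = 0
    · exact ⟨x, l.length / 2 + 1, by rw [e]; congr 1; omega⟩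
    · exfalso
      apply hl
      rcases Nat.even_or_odd l.length with h' | h'
      · exact absurd (Nat.even_iff.mp h') hp
      rw [altW_snoc] at e
      rw [List.getElem_of_eq e, List.getElem_append_right (by simp [altW_length])]
      simp only [altW_length, Nat.sub_self, List.getElem_cons_zero]
      split_ifs <;> first | omega | rfl

/-- no two distinct economical cyclic words in letters `a`, `b` are
equivalent: equivalent economical cyclic words are equal as cyclic words. -/
theorem economical_equiv_eq (u v : List AB)
    (hu : EconomicalW u) (hv : EconomicalW v) (h : EquivW u v) : CycEq u v := by
  have hi := altInv_equiv h
  rcases econ_form u hu with ⟨x, rfl⟩ | ⟨x, m, rfl⟩ <;>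
    rcases econ_form v hv with ⟨y, rfl⟩ | ⟨y, k, rfl⟩
  · refine ⟨0, ?_⟩
    cases x <;> cases y <;> simp [altInv, altT, AB.be] at hi ⊢
  · rw [altW_inv] at hi
    simp [altInv] at hi
  · rw [altW_inv] at hi
    simp [altInv] at hi
  · rw [altW_inv, altW_inv] at hi
    have hk : m = k := by simpa using hi
    subst hk
    by_cases hxy : x = y
    · exact ⟨0, by simp [hxy]⟩
    · refine ⟨1, ?_⟩
      rw [AB.eq_fl hxy]
      rcases m with _ | m
      · rfl
      · rw [show 2 * (m + 1) = 2 * m + 1 + 1 by ring, altW_snoc x.fl, altW.eq_2 x,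
          List.rotate_cons_succ, List.rotate_zero, AB.fl_fl]
        congr 2
        split_ifs <;> first | omega | rfl
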